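/- For every q ∈ [2,∞) there exists a constant c_q > 0, depending only on q and s, such that for every summable f : ℤ → ℝ one has ‖G(f)‖_q ≤ c_q ‖f‖_q, where G(f)(x) = (∫₀^∞ |∇(P_t f)|²(x) dt)^{1/2}. -/

import Mathlib

open MeasureTheory Real

/-- The kernel `K_s` of the fractional discrete Laplacian on `ℤ`. -/
noncomputable def Ker (s : ℝ) (m : ℤ) : ℝ :=
  if m = 0 then 0
  else ((4 : ℝ) ^ s * Real.Gamma (1 / 2 + s) / (Real.sqrt Real.pi * |Real.Gamma (-s)|)) *
    (Real.Gamma ((m.natAbs : ℝ) - s) / Real.Gamma ((m.natAbs : ℝ) + 1 + s))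

/-- The fractional discrete Laplacian `L = (-Δ)^s` acting pointwise. -/
noncomputable def Lop (s : ℝ) (f : ℤ → ℝ) : ℤ → ℝ :=
  fun x => ∑' y : ℤ, (f x - f y) * Ker s (x - y)

/-- The heat semigroup `P_t = exp (-t L)`, given by the exponential series of the
bounded operator `-tL` (evaluated pointwise). -/
noncomputable def heat (s t : ℝ) (f : ℤ → ℝ) : ℤ → ℝ :=
  fun x => ∑' n : ℕ, ((-t) ^ n / (n.factorial : ℝ)) * ((Lop s)^[n] f x)

/-- The squared modulus of the gradient, `|∇f|²(x) = Σ_y K_s(y-x) (f x - f y)²`. -/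
noncomputable def gradSq (s : ℝ) (f : ℤ → ℝ) (x : ℤ) : ℝ :=
  ∑' y : ℤ, Ker s (y - x) * (f x - f y) ^ 2

/-- The squared modulus of the modified gradient,
`|∇̃f|²(x) = Σ_{y : |f y| < |f x|} K_s(y-x) (f x - f y)²`. -/
noncomputable def mgradSq (s : ℝ) (f : ℤ → ℝ) (x : ℤ) : ℝ :=
  ∑' y : {y : ℤ // |f y| < |f x|}, Ker s ((y : ℤ) - x) * (f x - f (y : ℤ)) ^ 2

/-- The `ℓ^q` norm on `ℤ` with counting measure (for finite `q`). -/
noncomputable def lqNorm (q : ℝ) (f : ℤ → ℝ) : ℝ :=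
  (∑' x : ℤ, |f x| ^ q) ^ (1 / q)

open scoped ENNReal

/-! ### Averaging operators on nonnegative functions -/

theorem ENNReal.mul_rpow_sub_one (a : ℝ≥0∞) {p : ℝ} (hp : 1 ≤ p) : a * a ^ (p - 1) = a ^ p := by
  nth_rewrite 1 [← ENNReal.rpow_one a]
  rw [← ENNReal.rpow_add_of_nonneg _ _ zero_le_one (by linarith), add_sub_cancel]

/-- Hölder's inequality for sums of extended nonnegative reals. -/
theorem tsum_mul_le_Lp_mul_Lq {ι : Type*} {p q : ℝ} (hpq : p.HolderConjugate q)
    (f g : ι → ℝ≥0∞) :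
    ∑' i, f i * g i ≤ (∑' i, f i ^ p) ^ (1 / p) * (∑' i, g i ^ q) ^ (1 / q) := by
  let _ : MeasurableSpace ι := ⊤
  have h := ENNReal.lintegral_mul_le_Lp_mul_Lq Measure.count hpq
    (f := f) (g := g) (Measurable.of_discrete).aemeasurable (Measurable.of_discrete).aemeasurable
  simpa [lintegral_count] using h

/-- Jensen's inequality for the power function and a weighted average. -/
theorem rpow_tsum_mul_le {ι : Type*} {ρ : ι → ℝ≥0∞} (hρ : ∑' i, ρ i = 1) (g : ι → ℝ≥0∞)
    {m : ℝ} (hm : 1 ≤ m) : (∑' i, ρ i * g i) ^ m ≤ ∑' i, ρ i * g i ^ m := by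
  rcases hm.eq_or_lt with rfl | hm
  · simp
  have hm0 : 0 < m := by linarith
  have hc := (Real.HolderConjugate.conjExponent hm).symm
  have hn : 0 < Real.conjExponent m := hc.pos
  have hsum : 1 / Real.conjExponent m + 1 / m = 1 := by
    simpa [one_div] using hc.inv_add_inv_eq_one
  have h := tsum_mul_le_Lp_mul_Lq hc (fun i => ρ i ^ (1 / Real.conjExponent m))
    (fun i => ρ i ^ (1 / m) * g i)
  have e1 : ∀ i, ρ i ^ (1 / Real.conjExponent m) * (ρ i ^ (1 / m) * g i) = ρ i * g i := by
    intro i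
    rw [← mul_assoc, ← ENNReal.rpow_add_of_nonneg _ _ (by positivity) (by positivity), hsum,
      ENNReal.rpow_one]
  have e2 : ∀ i, (ρ i ^ (1 / Real.conjExponent m)) ^ Real.conjExponent m = ρ i := by
    intro i
    rw [← ENNReal.rpow_mul, one_div_mul_cancel hn.ne', ENNReal.rpow_one]
  have e3 : ∀ i, (ρ i ^ (1 / m) * g i) ^ m = ρ i * g i ^ m := by
    intro i
    rw [ENNReal.mul_rpow_of_nonneg _ _ hm0.le, ← ENNReal.rpow_mul, one_div_mul_cancel hm0.ne',
      ENNReal.rpow_one]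
  simp only [e1, e2, e3, hρ, ENNReal.one_rpow, one_mul] at h
  calc _ ≤ ((∑' i, ρ i * g i ^ m) ^ (1 / m)) ^ m := ENNReal.rpow_le_rpow h hm0.le
    _ = _ := by rw [← ENNReal.rpow_mul, one_div_mul_cancel hm0.ne', ENNReal.rpow_one]

/-- The average of `g` around a point with weights `ρ`. -/
noncomputable def avg (ρ : ℤ → ℝ≥0∞) (g : ℤ → ℝ≥0∞) (x : ℤ) : ℝ≥0∞ :=
  ∑' z, ρ z * g (x + z)

section avg

variable {ρ : ℤ → ℝ≥0∞}

theorem avg_mono {g h : ℤ → ℝ≥0∞} (hgh : g ≤ h) : avg ρ g ≤ avg ρ h := fun x =>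
  ENNReal.tsum_le_tsum fun z => by gcongr; exact hgh _

theorem avg_one (hρ : ∑' z, ρ z = 1) : avg ρ 1 = 1 := by
  funext x
  simp [avg, hρ]

theorem tsum_avg (hρ : ∑' z, ρ z = 1) (g : ℤ → ℝ≥0∞) : ∑' x, avg ρ g x = ∑' x, g x := by
  unfold avg
  rw [ENNReal.tsum_comm]
  have h : ∀ z, ∑' x, ρ z * g (x + z) = ρ z * ∑' x, g x := fun z => by
    rw [ENNReal.tsum_mul_left, ← (Equiv.addRight z).tsum_eq g]
    rfl
  simp only [h]
  rw [ENNReal.tsum_mul_right, hρ, one_mul]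

theorem tsum_avg_mul (hev : ∀ z, ρ (-z) = ρ z) (g h : ℤ → ℝ≥0∞) :
    ∑' x, avg ρ g x * h x = ∑' x, g x * avg ρ h x := by
  have h1 : ∑' x, avg ρ g x * h x = ∑' z, ∑' x, ρ z * g (x + z) * h x := by
    simp only [avg, ← ENNReal.tsum_mul_right]
    exact ENNReal.tsum_comm
  have h2 : ∑' x, g x * avg ρ h x = ∑' z, ∑' x, g x * (ρ z * h (x + z)) := by
    simp only [avg, ← ENNReal.tsum_mul_left]
    exact ENNReal.tsum_comm
  rw [h1, h2, ← (Equiv.neg ℤ).tsum_eq (fun z => ∑' x, g x * (ρ z * h (x + z)))]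
  refine tsum_congr fun z => ?_
  rw [← (Equiv.addRight z).tsum_eq (fun x => g x * (ρ (Equiv.neg ℤ z) * h (x + Equiv.neg ℤ z)))]
  refine tsum_congr fun x => ?_
  simp only [Equiv.neg_apply, Equiv.coe_addRight, hev, add_neg_cancel_right]
  ring

theorem rpow_avg_le (hρ : ∑' z, ρ z = 1) (g : ℤ → ℝ≥0∞) {m : ℝ} (hm : 1 ≤ m) (x : ℤ) :
    avg ρ g x ^ m ≤ avg ρ (fun y => g y ^ m) x :=
  rpow_tsum_mul_le hρ _ hm

theorem avg_rpow_le (hρ : ∑' z, ρ z = 1) (g : ℤ → ℝ≥0∞) {m : ℝ} (hm0 : 0 < m) (hm : m ≤ 1)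
    (x : ℤ) : avg ρ (fun y => g y ^ m) x ≤ avg ρ g x ^ m := by
  have h := rpow_avg_le hρ (fun y => g y ^ m) (one_le_one_div hm0 hm) x
  simp only [← ENNReal.rpow_mul, mul_one_div_cancel hm0.ne', ENNReal.rpow_one] at h
  calc _ = (avg ρ (fun y => g y ^ m) x ^ (1 / m)) ^ m := by
        rw [← ENNReal.rpow_mul, one_div_mul_cancel hm0.ne', ENNReal.rpow_one]
    _ ≤ _ := ENNReal.rpow_le_rpow h hm0.le

theorem tsum_rpow_avg_le (hρ : ∑' z, ρ z = 1) (g : ℤ → ℝ≥0∞) {m : ℝ} (hm : 1 ≤ m) :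
    ∑' x, avg ρ g x ^ m ≤ ∑' x, g x ^ m :=
  (ENNReal.tsum_le_tsum (rpow_avg_le hρ g hm)).trans_eq (tsum_avg hρ _)

/-- The value, with `k` steps to go, of optimally stopping the chain with weights `ρ` when the
reward after `n` steps is the `n`-fold average of `v`. -/
noncomputable def snell (ρ : ℤ → ℝ≥0∞) : ℕ → (ℤ → ℝ≥0∞) → ℤ → ℝ≥0∞
  | 0, v => v
  | k + 1, v => v ⊔ avg ρ (snell ρ k (avg ρ v))

theorem le_snell (k : ℕ) (v : ℤ → ℝ≥0∞) : v ≤ snell ρ k v := by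
  cases k
  · exact le_rfl
  · exact le_sup_left

theorem snell_mono (k : ℕ) {v w : ℤ → ℝ≥0∞} (h : v ≤ w) : snell ρ k v ≤ snell ρ k w := by
  induction k generalizing v w with
  | zero => exact h
  | succ k ih => exact sup_le_sup h (avg_mono (ih (avg_mono h)))

theorem snell_one (hρ : ∑' z, ρ z = 1) (k : ℕ) : snell ρ k 1 = 1 := by
  induction k with
  | zero => rfl
  | succ k ih => simp [snell, avg_one hρ, ih]

theorem snell_rpow_le (hρ : ∑' z, ρ z = 1) (k : ℕ) (v : ℤ → ℝ≥0∞) {m : ℝ} (hm : 1 ≤ m) (x : ℤ) :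
    snell ρ k v x ^ m ≤ snell ρ k (fun y => v y ^ m) x := by
  induction k generalizing v x with
  | zero => exact le_rfl
  | succ k ih =>
    have hmono : Monotone fun a : ℝ≥0∞ => a ^ m := ENNReal.monotone_rpow_of_nonneg (by linarith)
    have e : snell ρ (k + 1) v x ^ m =
        v x ^ m ⊔ avg ρ (snell ρ k (avg ρ v)) x ^ m := hmono.map_sup _ _
    rw [e]
    refine sup_le_sup le_rfl ((rpow_avg_le hρ _ hm x).trans (avg_mono (fun y => ?_) x))
    exact (ih (avg ρ v) y).trans (snell_mono k (fun z => rpow_avg_le hρ v hm z) y)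

theorem tsum_snell_rpow_ne_top (hρ : ∑' z, ρ z = 1) (k : ℕ) {v : ℤ → ℝ≥0∞} {b : ℝ} (hb : 1 ≤ b)
    (hv : ∑' x, v x ^ b ≠ ∞) : ∑' x, snell ρ k v x ^ b ≠ ∞ := by
  induction k generalizing v with
  | zero => exact hv
  | succ k ih =>
    have h1 := ih (v := avg ρ v) (ne_top_of_le_ne_top hv (tsum_rpow_avg_le hρ v hb))
    have h2 := ne_top_of_le_ne_top h1 (tsum_rpow_avg_le hρ (snell ρ k (avg ρ v)) hb)
    refine ne_top_of_le_ne_top (ENNReal.add_ne_top.2 ⟨hv, h2⟩) ?_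
    rw [← ENNReal.tsum_add]
    refine ENNReal.tsum_le_tsum fun x => ?_
    rcases le_total (v x) (avg ρ (snell ρ k (avg ρ v)) x) with h | h
    · simp only [snell, Pi.sup_apply, sup_eq_right.2 h]
      exact le_add_self
    · simp only [snell, Pi.sup_apply, sup_eq_left.2 h]
      exact le_self_add

theorem sup_rpow_add_le {b c : ℝ} (hbc : b.HolderConjugate c) (v y : ℝ≥0∞) :
    (v ⊔ y) ^ b + ENNReal.ofReal c * (v * y ^ (b - 1)) ≤
      y ^ b + ENNReal.ofReal c * (v * (v ⊔ y) ^ (b - 1)) := by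
  rcases le_total v y with h | h
  · rw [sup_eq_right.2 h]
  rw [sup_eq_left.2 h]
  have hb := hbc.pos
  have hc := hbc.symm.pos
  have hb1 := hbc.lt
  have hc1 := hbc.symm.lt
  have hY := ENNReal.young_inequality v (y ^ (b - 1)) hbc
  have hbc' : (b - 1) * c = b := hbc.sub_one_mul_conj
  rw [← ENNReal.rpow_mul, hbc'] at hY
  rw [ENNReal.mul_rpow_sub_one v hb1.le]
  have hc0 : ENNReal.ofReal c ≠ 0 := by simpa using hc
  have hcb : c / b = c - 1 := by
    have := hbc.symm.sub_one_mul_conj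
    field_simp
    linarith
  have key : ENNReal.ofReal c * (v * y ^ (b - 1)) ≤ ENNReal.ofReal (c - 1) * v ^ b + y ^ b := by
    calc _ ≤ ENNReal.ofReal c * (v ^ b / ENNReal.ofReal b + y ^ b / ENNReal.ofReal c) := by gcongr
      _ = ENNReal.ofReal c / ENNReal.ofReal b * v ^ b + y ^ b := by
        rw [mul_add, ENNReal.mul_div_cancel hc0 ENNReal.ofReal_ne_top]
        congr 1
        simp only [div_eq_mul_inv]; ring
      _ = _ := by rw [← ENNReal.ofReal_div_of_pos hb, hcb]
  calc _ ≤ v ^ b + (ENNReal.ofReal (c - 1) * v ^ b + y ^ b) := by gcongr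
    _ = y ^ b + (1 + ENNReal.ofReal (c - 1)) * v ^ b := by ring
    _ = _ := by
      rw [← ENNReal.ofReal_one, ← ENNReal.ofReal_add zero_le_one (by linarith)]
      congr 3; ring

theorem tsum_snell_rpow_le_mul (hρ : ∑' z, ρ z = 1) (hev : ∀ z, ρ (-z) = ρ z) {b c : ℝ}
    (hbc : b.HolderConjugate c) (hb2 : b ≤ 2) (k : ℕ) {v : ℤ → ℝ≥0∞} (hv : ∑' x, v x ^ b ≠ ∞) :
    ∑' x, snell ρ k v x ^ b ≤ ENNReal.ofReal c * ∑' x, v x * snell ρ k v x ^ (b - 1) := by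
  have hb1 := hbc.lt
  have hself : ∀ a : ℝ≥0∞, a * a ^ (b - 1) = a ^ b := fun a => a.mul_rpow_sub_one hb1.le
  induction k generalizing v with
  | zero =>
    simp only [snell, hself]
    exact le_mul_of_one_le_left' (by simpa using hbc.symm.lt.le)
  | succ k ih =>
    have hv' := ne_top_of_le_ne_top hv (tsum_rpow_avg_le hρ v hb1.le)
    have hfin := tsum_snell_rpow_ne_top hρ (k + 1) hb1.le hv
    have ih' := ih hv'
    set u := snell ρ k (avg ρ v) with hu
    set w := snell ρ (k + 1) v with hw
    have hwv : ∀ x, w x = v x ⊔ avg ρ u x := fun x => rfl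
    have hA : ∑' x, v x * avg ρ u x ^ (b - 1) ≠ ∞ := by
      refine ne_top_of_le_ne_top hfin (ENNReal.tsum_le_tsum fun x => ?_)
      rw [← hself, hwv]
      have : 0 ≤ b - 1 := by linarith
      gcongr
      · exact le_sup_left
      · exact le_sup_right
    have h1 : ∑' x, w x ^ b + ENNReal.ofReal c * ∑' x, v x * avg ρ u x ^ (b - 1) ≤
        ∑' x, avg ρ u x ^ b + ENNReal.ofReal c * ∑' x, v x * w x ^ (b - 1) := by
      simp only [← ENNReal.tsum_mul_left, ← ENNReal.tsum_add]
      exact ENNReal.tsum_le_tsum fun x => sup_rpow_add_le hbc _ _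
    have h2 : ∑' x, avg ρ u x ^ b ≤ ENNReal.ofReal c * ∑' x, v x * avg ρ u x ^ (b - 1) := by
      refine (tsum_rpow_avg_le hρ u hb1.le).trans (ih'.trans ?_)
      rw [tsum_avg_mul hev]
      gcongr
      exact avg_rpow_le hρ u (by linarith) (by linarith) _
    have h3 := h1.trans (add_le_add_left h2 _)
    rw [add_comm] at h3
    exact (ENNReal.add_le_add_iff_left (ENNReal.mul_ne_top ENNReal.ofReal_ne_top hA)).1 h3

theorem le_rpow_mul_of_le_mul_rpow {b c : ℝ} (hbc : b.HolderConjugate c) {A V C : ℝ≥0∞}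
    (hA : A ≠ ∞) (h : A ≤ C * (V ^ (1 / b) * A ^ (1 / c))) : A ≤ C ^ b * V := by
  have hb := hbc.pos
  rcases eq_or_ne A 0 with rfl | hA0
  · exact zero_le
  have hA' : A ^ (1 / c) ≠ 0 := by simp [ENNReal.rpow_eq_zero_iff, hA0, hA]
  have hA'' : A ^ (1 / c) ≠ ∞ :=
    ENNReal.rpow_ne_top_of_nonneg (by have := hbc.symm.pos; positivity) hA
  have hs : 1 / b + 1 / c = 1 := by simpa [one_div] using hbc.inv_add_inv_eq_one
  have e : A = A ^ (1 / b) * A ^ (1 / c) := by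
    rw [← ENNReal.rpow_add _ _ hA0 hA, hs, ENNReal.rpow_one]
  have h' : A ^ (1 / b) * A ^ (1 / c) ≤ (C * V ^ (1 / b)) * A ^ (1 / c) := by
    rw [← e, mul_assoc]; exact h
  have h2 := (ENNReal.mul_le_mul_iff_left hA' hA'').1 h'
  calc A = (A ^ (1 / b)) ^ b := by
        rw [← ENNReal.rpow_mul, one_div_mul_cancel hb.ne', ENNReal.rpow_one]
    _ ≤ (C * V ^ (1 / b)) ^ b := ENNReal.rpow_le_rpow h2 hb.le
    _ = _ := by
      rw [ENNReal.mul_rpow_of_nonneg _ _ hb.le, ← ENNReal.rpow_mul, one_div_mul_cancel hb.ne',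
        ENNReal.rpow_one]

theorem tsum_snell_rpow_le_of_le_two (hρ : ∑' z, ρ z = 1) (hev : ∀ z, ρ (-z) = ρ z) {b c : ℝ}
    (hbc : b.HolderConjugate c) (hb2 : b ≤ 2) (k : ℕ) {v : ℤ → ℝ≥0∞} (hv : ∑' x, v x ^ b ≠ ∞) :
    ∑' x, snell ρ k v x ^ b ≤ ENNReal.ofReal c ^ b * ∑' x, v x ^ b := by
  have hfin := tsum_snell_rpow_ne_top hρ k hbc.lt.le hv
  refine le_rpow_mul_of_le_mul_rpow hbc hfin ?_
  refine (tsum_snell_rpow_le_mul hρ hev hbc hb2 k hv).trans ?_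
  gcongr
  refine (tsum_mul_le_Lp_mul_Lq hbc _ _).trans_eq ?_
  simp only [← ENNReal.rpow_mul, hbc.sub_one_mul_conj]

/-- Doob's maximal inequality for the optimal stopping value. -/
theorem exists_tsum_snell_rpow_le {b : ℝ} (hb : 1 < b) :
    ∃ C : ℝ≥0∞, C ≠ ∞ ∧ ∀ ρ : ℤ → ℝ≥0∞, ∑' z, ρ z = 1 → (∀ z, ρ (-z) = ρ z) →
      ∀ (k : ℕ) (v : ℤ → ℝ≥0∞), ∑' x, v x ^ b ≠ ∞ →
        ∑' x, snell ρ k v x ^ b ≤ C * ∑' x, v x ^ b := by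
  rcases le_total b 2 with h2 | h2
  · have hbc := Real.HolderConjugate.conjExponent hb
    exact ⟨_, ENNReal.rpow_ne_top_of_nonneg hbc.nonneg ENNReal.ofReal_ne_top,
      fun ρ hρ hev k v hv => tsum_snell_rpow_le_of_le_two hρ hev hbc h2 k hv⟩
  · refine ⟨_, ENNReal.rpow_ne_top_of_nonneg zero_le_two (ENNReal.ofReal_ne_top (r := 2)),
      fun ρ hρ hev k v hv => ?_⟩
    have hm : 1 ≤ b / 2 := by linarith
    have e : ∀ a : ℝ≥0∞, (a ^ (b / 2)) ^ (2 : ℝ) = a ^ b := fun a => by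
      rw [← ENNReal.rpow_mul, div_mul_cancel₀ _ (two_ne_zero)]
    have h := tsum_snell_rpow_le_of_le_two hρ hev Real.HolderConjugate.two_two le_rfl k
      (v := fun x => v x ^ (b / 2)) (by simpa only [e] using hv)
    simp only [e] at h
    refine le_trans (ENNReal.tsum_le_tsum fun x => ?_) h
    rw [← e]
    exact ENNReal.rpow_le_rpow (snell_rpow_le hρ k v hm x) zero_le_two

end avg

section energy

variable {ρ : ℤ → ℝ≥0∞}

theorem tsum_iterate_avg_mul (hev : ∀ z, ρ (-z) = ρ z) (n : ℕ) (g h : ℤ → ℝ≥0∞) :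
    ∑' x, (avg ρ)^[n] g x * h x = ∑' x, g x * (avg ρ)^[n] h x := by
  induction n generalizing g h with
  | zero => rfl
  | succ n ih =>
    rw [Function.iterate_succ_apply, ih, tsum_avg_mul hev,
      ← Function.iterate_succ_apply' (avg ρ)]

theorem sum_energy_le (hev : ∀ z, ρ (-z) = ρ z) (N : ℕ) {e s : ℕ → ℤ → ℝ≥0∞}
    (hes : ∀ n x, e n x + 3 * s (n + 1) x ≤ 3 * avg ρ (s n) x) (h : ℤ → ℝ≥0∞) :
    ∑ n ∈ Finset.range N, ∑' x, e n x * (avg ρ)^[n + 1] h x ≤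
      3 * ∑' x, s 0 x * snell ρ N h x := by
  induction N generalizing e s h with
  | zero => simp
  | succ N ih =>
    set w := snell ρ N (avg ρ h) with hw
    have h1 := ih (e := fun n => e (n + 1)) (s := fun n => s (n + 1)) (fun n x => hes (n + 1) x)
      (avg ρ h)
    simp only [← Function.iterate_succ_apply, zero_add] at h1
    rw [Finset.sum_range_succ']
    calc _ ≤ 3 * ∑' x, s 1 x * w x + ∑' x, e 0 x * w x := by
          refine add_le_add h1 (ENNReal.tsum_le_tsum fun x => ?_)
          gcongr
          exact le_snell N (avg ρ h) x
      _ = ∑' x, (e 0 x + 3 * s 1 x) * w x := by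
          rw [← ENNReal.tsum_mul_left, ← ENNReal.tsum_add]
          exact tsum_congr fun x => by ring
      _ ≤ ∑' x, 3 * avg ρ (s 0) x * w x := by
          refine ENNReal.tsum_le_tsum fun x => ?_
          gcongr
          exact hes 0 x
      _ = 3 * ∑' x, s 0 x * avg ρ w x := by
          simp only [mul_assoc]
          rw [ENNReal.tsum_mul_left, tsum_avg_mul hev]
      _ ≤ _ := by
          gcongr
          exact (le_sup_right : avg ρ w ≤ h ⊔ avg ρ w) _

/-- The accumulated energy averaged back along the chain. -/
noncomputable def avgEnergy (ρ : ℤ → ℝ≥0∞) (e : ℕ → ℤ → ℝ≥0∞) (x : ℤ) : ℝ≥0∞ :=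
  ∑' n, (avg ρ)^[n + 1] (e n) x

theorem tsum_avgEnergy_mul_le (hev : ∀ z, ρ (-z) = ρ z) {e s : ℕ → ℤ → ℝ≥0∞}
    (hes : ∀ n x, e n x + 3 * s (n + 1) x ≤ 3 * avg ρ (s n) x) (h : ℤ → ℝ≥0∞) {B : ℝ≥0∞}
    (hB : ∀ N, ∑' x, s 0 x * snell ρ N h x ≤ B) :
    ∑' x, avgEnergy ρ e x * h x ≤ 3 * B := by
  have h1 : ∑' x, avgEnergy ρ e x * h x = ∑' n, ∑' x, e n x * (avg ρ)^[n + 1] h x := by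
    simp only [avgEnergy, ← ENNReal.tsum_mul_right]
    rw [ENNReal.tsum_comm]
    exact tsum_congr fun n => tsum_iterate_avg_mul hev _ _ _
  rw [h1]
  refine ENNReal.tsum_le_of_sum_range_le fun N => (sum_energy_le hev N hes h).trans ?_
  gcongr
  exact hB N

theorem tsum_avgEnergy_le (hρ : ∑' z, ρ z = 1) (hev : ∀ z, ρ (-z) = ρ z) {e s : ℕ → ℤ → ℝ≥0∞}
    (hes : ∀ n x, e n x + 3 * s (n + 1) x ≤ 3 * avg ρ (s n) x) :
    ∑' x, avgEnergy ρ e x ≤ 3 * ∑' x, s 0 x := by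
  have h := tsum_avgEnergy_mul_le hev hes 1 (B := ∑' x, s 0 x)
    (fun N => by simp [snell_one hρ])
  simpa using h

theorem tsum_rpow_le_rpow_tsum {ι : Type*} (S : ι → ℝ≥0∞) {p : ℝ} (hp : 1 ≤ p) :
    ∑' x, S x ^ p ≤ (∑' x, S x) ^ p := by
  have hp' : 0 ≤ p - 1 := by linarith
  have hself : ∀ a : ℝ≥0∞, a * a ^ (p - 1) = a ^ p := fun a => a.mul_rpow_sub_one hp
  rw [← hself (∑' x, S x), ← ENNReal.tsum_mul_right]
  refine ENNReal.tsum_le_tsum fun x => ?_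
  rw [← hself]
  gcongr
  exact ENNReal.le_tsum x

theorem exists_tsum_avgEnergy_rpow_le {p : ℝ} (hp : 1 ≤ p) :
    ∃ C : ℝ≥0∞, C ≠ ∞ ∧ ∀ ρ : ℤ → ℝ≥0∞, ∑' z, ρ z = 1 → (∀ z, ρ (-z) = ρ z) →
      ∀ e s : ℕ → ℤ → ℝ≥0∞, (∀ n x, e n x + 3 * s (n + 1) x ≤ 3 * avg ρ (s n) x) →
        ∑' x, s 0 x ≠ ∞ → ∑' x, avgEnergy ρ e x ^ p ≤ C * ∑' x, s 0 x ^ p := by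
  rcases hp.eq_or_lt with rfl | hp1
  · exact ⟨3, by simp, fun ρ hρ hev e s hes _ => by simpa using tsum_avgEnergy_le hρ hev hes⟩
  have hpb := Real.HolderConjugate.conjExponent hp1
  set b := Real.conjExponent p
  have hp0 := hpb.pos
  have hb0 := hpb.symm.pos
  obtain ⟨C, hC, hsn⟩ := exists_tsum_snell_rpow_le hpb.symm.lt
  refine ⟨(3 * C ^ (1 / b)) ^ p, ENNReal.rpow_ne_top_of_nonneg hp0.le
    (ENNReal.mul_ne_top (by simp) (ENNReal.rpow_ne_top_of_nonneg (by positivity) hC)),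
    fun ρ hρ hev e s hes hs => ?_⟩
  set S := avgEnergy ρ e
  have hfin : ∑' x, S x ^ p ≠ ∞ :=
    ne_top_of_le_ne_top (ENNReal.rpow_ne_top_of_nonneg hp0.le
      (ne_top_of_le_ne_top (ENNReal.mul_ne_top (by simp) hs) (tsum_avgEnergy_le hρ hev hes)))
      (tsum_rpow_le_rpow_tsum S hp)
  have hh : ∀ x, (S x ^ (p - 1)) ^ b = S x ^ p := fun x => by
    rw [← ENNReal.rpow_mul, hpb.sub_one_mul_conj]
  have hself : ∀ a : ℝ≥0∞, a * a ^ (p - 1) = a ^ p := fun a => a.mul_rpow_sub_one hp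
  refine le_rpow_mul_of_le_mul_rpow hpb hfin ?_
  have h := tsum_avgEnergy_mul_le hev hes (fun x => S x ^ (p - 1))
    (B := (∑' x, s 0 x ^ p) ^ (1 / p) * (C * ∑' x, S x ^ p) ^ (1 / b)) fun N => by
      refine (tsum_mul_le_Lp_mul_Lq hpb _ _).trans ?_
      gcongr
      refine (hsn ρ hρ hev N (fun x => S x ^ (p - 1)) (by simpa only [hh] using hfin)).trans_eq ?_
      simp only [hh]
  simp only [S, hself] at h
  refine h.trans_eq ?_
  rw [ENNReal.mul_rpow_of_nonneg _ _ (by positivity)]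
  ring

theorem le_iterate_avg {e : ℕ → ℤ → ℝ≥0∞} (he : ∀ n, e (n + 1) ≤ avg ρ (e n)) (n k : ℕ) :
    e (n + k) ≤ (avg ρ)^[k] (e n) := by
  induction k with
  | zero => exact le_rfl
  | succ k ih =>
    rw [Function.iterate_succ_apply']
    exact (he _).trans (avg_mono ih)

theorem le_two_mul_avg (h0 : 1 ≤ 2 * ρ 0) (g : ℤ → ℝ≥0∞) (x : ℤ) : g x ≤ 2 * avg ρ g x := by
  calc g x ≤ 2 * ρ 0 * g x := le_mul_of_one_le_left' h0
    _ = 2 * (ρ 0 * g (x + 0)) := by rw [add_zero, mul_assoc]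
    _ ≤ _ := by
      gcongr
      exact ENNReal.le_tsum (f := fun z => ρ z * g (x + z)) 0

theorem tsum_energy_le_avgEnergy (h0 : 1 ≤ 2 * ρ 0) {e : ℕ → ℤ → ℝ≥0∞}
    (he : ∀ n, e (n + 1) ≤ avg ρ (e n)) (x : ℤ) :
    ∑' n, e n x ≤ 3 * avgEnergy ρ e x := by
  rw [← tsum_even_add_odd (f := fun n => e n x) ENNReal.summable ENNReal.summable,
    ← ENNReal.tsum_add, avgEnergy, ← ENNReal.tsum_mul_left]
  refine ENNReal.tsum_le_tsum fun n => ?_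
  have h1 : e (2 * n) x ≤ 2 * (avg ρ)^[n + 1] (e n) x := by
    rw [Function.iterate_succ_apply', two_mul]
    exact (le_iterate_avg he n n x).trans (le_two_mul_avg h0 _ x)
  have h2 : e (2 * n + 1) x ≤ (avg ρ)^[n + 1] (e n) x := by
    rw [two_mul, add_assoc]
    exact le_iterate_avg he n (n + 1) x
  calc _ ≤ 2 * (avg ρ)^[n + 1] (e n) x + (avg ρ)^[n + 1] (e n) x := add_le_add h1 h2
    _ = _ := by ring

/-- The abstract square function estimate for a lazy symmetric random walk. -/
theorem exists_tsum_energy_rpow_le {p : ℝ} (hp : 1 ≤ p) :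
    ∃ C : ℝ≥0∞, C ≠ ∞ ∧ ∀ ρ : ℤ → ℝ≥0∞, ∑' z, ρ z = 1 → (∀ z, ρ (-z) = ρ z) → 1 ≤ 2 * ρ 0 →
      ∀ e s : ℕ → ℤ → ℝ≥0∞, (∀ n x, e n x + 3 * s (n + 1) x ≤ 3 * avg ρ (s n) x) →
        (∀ n, e (n + 1) ≤ avg ρ (e n)) → ∑' x, s 0 x ≠ ∞ →
          ∑' x, (∑' n, e n x) ^ p ≤ C * ∑' x, s 0 x ^ p := by
  have hp0 : 0 ≤ p := by linarith
  obtain ⟨C, hC, h⟩ := exists_tsum_avgEnergy_rpow_le hp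
  refine ⟨3 ^ p * C, ENNReal.mul_ne_top (ENNReal.rpow_ne_top_of_nonneg hp0 (by simp)) hC,
    fun ρ hρ hev h0 e s hes he hs => ?_⟩
  calc _ ≤ ∑' x, (3 * avgEnergy ρ e x) ^ p :=
        ENNReal.tsum_le_tsum fun x =>
          ENNReal.rpow_le_rpow (tsum_energy_le_avgEnergy h0 he x) hp0
    _ = 3 ^ p * ∑' x, avgEnergy ρ e x ^ p := by
        simp only [ENNReal.mul_rpow_of_nonneg _ _ hp0, ENNReal.tsum_mul_left]
    _ ≤ _ := by
        rw [mul_assoc]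
        gcongr
        exact h ρ hρ hev e s hes hs

end energy

/-! ### Averaging operators on bounded real functions -/

section real

theorem summable_mul_of_bdd {ι : Type*} {a g : ι → ℝ} {B : ℝ} (ha0 : ∀ i, 0 ≤ a i)
    (ha : Summable a) (hg : ∀ i, |g i| ≤ B) : Summable fun i => a i * g i := by
  refine Summable.of_norm_bounded (ha.mul_right B) fun i => ?_
  rw [Real.norm_eq_abs, abs_mul, abs_of_nonneg (ha0 i)]
  exact mul_le_mul_of_nonneg_left (hg i) (ha0 i)

theorem summable_mul_sq_of_bdd {ι : Type*} {a g : ι → ℝ} {B : ℝ} (ha0 : ∀ i, 0 ≤ a i)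
    (ha : Summable a) (hg : ∀ i, |g i| ≤ B) : Summable fun i => a i * g i ^ 2 :=
  summable_mul_of_bdd (B := B ^ 2) ha0 ha fun i => by
    rw [abs_pow]
    exact pow_le_pow_left₀ (abs_nonneg _) (hg i) 2

theorem hasSum_mul_sub_sq {ι : Type*} {a g : ι → ℝ} {B : ℝ} (ha0 : ∀ i, 0 ≤ a i)
    (ha : HasSum a 1) (hg : ∀ i, |g i| ≤ B) (m : ℝ) :
    HasSum (fun i => a i * (g i - m) ^ 2)
      (∑' i, a i * g i ^ 2 - 2 * m * ∑' i, a i * g i + m ^ 2) := by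
  have h1 := (summable_mul_of_bdd ha0 ha.summable hg).hasSum.mul_left (2 * m)
  have h2 := (summable_mul_sq_of_bdd ha0 ha.summable hg).hasSum
  have h3 := (h2.sub h1).add (ha.mul_left (m ^ 2))
  rw [mul_one] at h3
  exact h3.congr_fun fun i => by ring

theorem sq_tsum_mul_le {ι : Type*} {a g : ι → ℝ} {B : ℝ} (ha0 : ∀ i, 0 ≤ a i)
    (ha : HasSum a 1) (hg : ∀ i, |g i| ≤ B) :
    (∑' i, a i * g i) ^ 2 ≤ ∑' i, a i * g i ^ 2 := by
  have h := (hasSum_mul_sub_sq ha0 ha hg (∑' i, a i * g i)).nonneg fun i =>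
    mul_nonneg (ha0 i) (sq_nonneg _)
  linarith

theorem ofReal_tsum_mul_sq {ι : Type*} {a g : ι → ℝ} {B : ℝ} (ha0 : ∀ i, 0 ≤ a i)
    (ha : Summable a) (hg : ∀ i, |g i| ≤ B) :
    ENNReal.ofReal (∑' i, a i * g i ^ 2) =
      ∑' i, ENNReal.ofReal (a i) * ENNReal.ofReal (g i ^ 2) := by
  rw [ENNReal.ofReal_tsum_of_nonneg (fun i => mul_nonneg (ha0 i) (sq_nonneg _))
    (summable_mul_sq_of_bdd ha0 ha hg)]
  exact tsum_congr fun i => ENNReal.ofReal_mul (ha0 i)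

theorem ofReal_sq_tsum_mul_le {ι : Type*} {a g : ι → ℝ} {B : ℝ} (ha0 : ∀ i, 0 ≤ a i)
    (ha : HasSum a 1) (hg : ∀ i, |g i| ≤ B) :
    ENNReal.ofReal ((∑' i, a i * g i) ^ 2) ≤
      ∑' i, ENNReal.ofReal (a i) * ENNReal.ofReal (g i ^ 2) :=
  (ENNReal.ofReal_le_ofReal (sq_tsum_mul_le ha0 ha hg)).trans_eq
    (ofReal_tsum_mul_sq ha0 ha.summable hg)

/-- The average of a real function around a point with weights `r`. -/
noncomputable def realAvg (r : ℤ → ℝ) (u : ℤ → ℝ) (x : ℤ) : ℝ :=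
  ∑' z, r z * u (x + z)

/-- The energy density of `u` at a point for the random walk with weights `r`. -/
noncomputable def energy (r : ℤ → ℝ) (u : ℤ → ℝ) (x : ℤ) : ℝ≥0∞ :=
  ∑' z, ENNReal.ofReal (r z) * ENNReal.ofReal ((u (x + z) - u x) ^ 2)

variable {r : ℤ → ℝ} {u : ℤ → ℝ} {B : ℝ}

theorem abs_realAvg_le (hr0 : ∀ z, 0 ≤ r z) (hr : HasSum r 1) (hu : ∀ x, |u x| ≤ B) (x : ℤ) :
    |realAvg r u x| ≤ B := by
  have h := tsum_of_norm_bounded (f := fun z => r z * u (x + z)) (hr.mul_right B) fun z => by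
    rw [Real.norm_eq_abs, abs_mul, abs_of_nonneg (hr0 z)]
    exact mul_le_mul_of_nonneg_left (hu _) (hr0 z)
  rwa [one_mul] at h

theorem abs_iterate_realAvg_le (hr0 : ∀ z, 0 ≤ r z) (hr : HasSum r 1) (hu : ∀ x, |u x| ≤ B)
    (n : ℕ) (x : ℤ) : |(realAvg r)^[n] u x| ≤ B := by
  induction n generalizing x with
  | zero => exact hu x
  | succ n ih =>
    rw [Function.iterate_succ_apply']
    exact abs_realAvg_le hr0 hr ih x

theorem energy_add_le (hr0 : ∀ z, 0 ≤ r z) (hr : HasSum r 1) (h0 : 1 ≤ 2 * r 0)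
    (hu : ∀ x, |u x| ≤ B) (x : ℤ) :
    energy r u x + 3 * ENNReal.ofReal (realAvg r u x ^ 2) ≤
      3 * avg (fun z => ENNReal.ofReal (r z)) (fun y => ENNReal.ofReal (u y ^ 2)) x := by
  have hg : ∀ z, |u (x + z)| ≤ B := fun z => hu _
  have h3 : (3 : ℝ≥0∞) = ENNReal.ofReal 3 := by simp
  have hE := hasSum_mul_sub_sq hr0 hr hg (u x)
  have hV := hasSum_mul_sub_sq hr0 hr hg (realAvg r u x)
  have e1 : energy r u x = ENNReal.ofReal (∑' z, r z * (u (x + z) - u x) ^ 2) :=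
    (ofReal_tsum_mul_sq (B := B + B) hr0 hr.summable fun z =>
      (abs_sub _ _).trans (add_le_add (hu _) (hu _))).symm
  have e2 : avg (fun z => ENNReal.ofReal (r z)) (fun y => ENNReal.ofReal (u y ^ 2)) x =
      ENNReal.ofReal (∑' z, r z * u (x + z) ^ 2) := (ofReal_tsum_mul_sq hr0 hr.summable hg).symm
  have hnn : ∀ z, 0 ≤ r z * (u (x + z) - u x) ^ 2 := fun z => mul_nonneg (hr0 z) (sq_nonneg _)
  rw [e1, e2, h3, ← ENNReal.ofReal_mul (by norm_num), ← ENNReal.ofReal_mul (by norm_num),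
    ← ENNReal.ofReal_add (tsum_nonneg hnn) (by positivity)]
  refine ENNReal.ofReal_le_ofReal ?_
  have hle := le_hasSum hV 0 fun z _ => mul_nonneg (hr0 z) (sq_nonneg _)
  rw [hE.tsum_eq]
  change _ ≤ _ - 2 * _ * realAvg r u x + _ at hle
  change _ - 2 * _ * realAvg r u x + _ + _ ≤ _
  rw [add_zero] at hle
  nlinarith [mul_nonneg (sub_nonneg.2 h0) (sq_nonneg (u x - realAvg r u x))]

theorem energy_realAvg_le (hr0 : ∀ z, 0 ≤ r z) (hr : HasSum r 1) (hu : ∀ x, |u x| ≤ B) :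
    energy r (realAvg r u) ≤ avg (fun z => ENNReal.ofReal (r z)) (energy r u) := by
  intro x
  have h : avg (fun z => ENNReal.ofReal (r z)) (energy r u) x = ∑' z, ENNReal.ofReal (r z) *
      ∑' w, ENNReal.ofReal (r w) * ENNReal.ofReal ((u (x + z + w) - u (x + w)) ^ 2) := by
    simp only [avg, energy, ← ENNReal.tsum_mul_left]
    rw [ENNReal.tsum_comm]
    refine tsum_congr fun z => tsum_congr fun w => ?_
    rw [mul_left_comm, add_right_comm]
  rw [h]
  refine ENNReal.tsum_le_tsum fun z => ?_
  gcongr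
  have e : realAvg r u (x + z) - realAvg r u x = ∑' w, r w * (u (x + z + w) - u (x + w)) := by
    rw [realAvg, realAvg, ← Summable.tsum_sub (summable_mul_of_bdd hr0 hr.summable fun _ => hu _)
      (summable_mul_of_bdd hr0 hr.summable fun _ => hu _)]
    exact tsum_congr fun w => by ring
  rw [e]
  exact ofReal_sq_tsum_mul_le (B := B + B) hr0 hr fun w =>
    (abs_sub _ _).trans (add_le_add (hu _) (hu _))

/-- The square function estimate for the powers of a lazy symmetric random walk. -/
theorem exists_tsum_tsum_energy_rpow_le {p : ℝ} (hp : 1 ≤ p) :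
    ∃ C : ℝ≥0∞, C ≠ ∞ ∧ ∀ r : ℤ → ℝ, (∀ z, 0 ≤ r z) → HasSum r 1 → (∀ z, r (-z) = r z) →
      1 ≤ 2 * r 0 → ∀ (f : ℤ → ℝ) (B : ℝ), (∀ x, |f x| ≤ B) →
        ∑' x, ENNReal.ofReal (f x ^ 2) ≠ ∞ →
          ∑' x, (∑' n, energy r ((realAvg r)^[n] f) x) ^ p ≤
            C * ∑' x, ENNReal.ofReal (f x ^ 2) ^ p := by
  obtain ⟨C, hC, h⟩ := exists_tsum_energy_rpow_le hp
  refine ⟨C, hC, fun r hr0 hr hev h0 f B hf hs => ?_⟩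
  have hb := abs_iterate_realAvg_le hr0 hr hf
  refine h (fun z => ENNReal.ofReal (r z)) ?_ (fun z => by rw [hev]) ?_
    (fun n => energy r ((realAvg r)^[n] f))
    (fun n x => ENNReal.ofReal ((realAvg r)^[n] f x ^ 2)) (fun n x => ?_) (fun n => ?_) hs
  · rw [← ENNReal.ofReal_tsum_of_nonneg hr0 hr.summable, hr.tsum_eq, ENNReal.ofReal_one]
  · rw [← ENNReal.ofReal_ofNat, ← ENNReal.ofReal_mul (by norm_num),
      ENNReal.one_le_ofReal]
    exact h0
  · simp only [Function.iterate_succ_apply']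
    exact energy_add_le hr0 hr h0 (hb n) x
  · simp only [Function.iterate_succ_apply']
    exact energy_realAvg_le hr0 hr (hb n)

end real

/-! ### The fractional kernel and its semigroup -/

section kernel

variable {s : ℝ}

theorem Ker_neg (m : ℤ) : Ker s (-m) = Ker s m := by
  simp [Ker]

theorem Ker_nonneg (hs : s ∈ Set.Ioo (0 : ℝ) 1) (m : ℤ) : 0 ≤ Ker s m := by
  obtain ⟨h0, h1⟩ := hs
  unfold Ker
  split_ifs with hm
  · exact le_rfl
  have hm1 : (1 : ℝ) ≤ m.natAbs := by exact_mod_cast Int.natAbs_pos.2 hm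
  have g1 := Real.Gamma_pos_of_pos (show 0 < (m.natAbs : ℝ) - s by linarith)
  have g2 := Real.Gamma_pos_of_pos (show 0 < (m.natAbs : ℝ) + 1 + s by linarith)
  have g3 := Real.Gamma_pos_of_pos (show 0 < 1 / 2 + s by linarith)
  positivity

theorem Gamma_div_Gamma_sub (hs : 0 < s) {x : ℝ} (hx : s < x) :
    Real.Gamma (x - s) / Real.Gamma (x + s) - Real.Gamma (x + 1 - s) / Real.Gamma (x + 1 + s) =
      2 * s * (Real.Gamma (x - s) / Real.Gamma (x + 1 + s)) := by
  have h1 : x + 1 - s = x - s + 1 := by ring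
  have h2 : x + 1 + s = x + s + 1 := by ring
  have hp : 0 < x + s := by linarith
  have hg := (Real.Gamma_pos_of_pos hp).ne'
  rw [h1, h2, Real.Gamma_add_one (by linarith), Real.Gamma_add_one hp.ne']
  field_simp
  ring

theorem summable_Ker (hs : s ∈ Set.Ioo (0 : ℝ) 1) : Summable (Ker s) := by
  have hnat : Summable fun n : ℕ => Ker s n := by
    rw [← summable_nat_add_iff 1]
    set C := (4 : ℝ) ^ s * Real.Gamma (1 / 2 + s) / (Real.sqrt Real.pi * |Real.Gamma (-s)|)
      with hC
    have hC0 : 0 ≤ C := by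
      have g3 := Real.Gamma_pos_of_pos (show 0 < 1 / 2 + s by linarith [hs.1])
      positivity
    set T : ℕ → ℝ := fun n => C / (2 * s) *
      (Real.Gamma ((n : ℝ) + 1 - s) / Real.Gamma ((n : ℝ) + 1 + s)) with hT
    have hT0 : ∀ n, 0 ≤ T n := fun n => by
      have hn : (0 : ℝ) ≤ n := n.cast_nonneg
      have g1 := Real.Gamma_pos_of_pos (show 0 < (n : ℝ) + 1 - s by linarith [hs.2])
      have g2 := Real.Gamma_pos_of_pos (show 0 < (n : ℝ) + 1 + s by linarith [hs.1])
      have := hs.1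
      positivity
    have hK : ∀ n : ℕ, Ker s ((n + 1 : ℕ) : ℤ) = T n - T (n + 1) := fun n => by
      have hn : (0 : ℝ) ≤ n := n.cast_nonneg
      have h := Gamma_div_Gamma_sub hs.1 (x := (n : ℝ) + 1) (by linarith [hs.2])
      have hs0 := hs.1.ne'
      have hne : ((n + 1 : ℕ) : ℤ) ≠ 0 := by positivity
      rw [Ker, if_neg hne, ← hC, hT]
      rw [Int.natAbs_natCast, Nat.cast_add, Nat.cast_one]
      simp only [Nat.cast_add, Nat.cast_one]
      rw [← mul_sub, h]
      field_simp
    refine summable_of_sum_range_le (c := T 0) (fun n => Ker_nonneg hs _) fun n => ?_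
    simp only [hK, Finset.sum_range_sub']
    linarith [hT0 n]
  refine Summable.of_nat_of_neg hnat ?_
  simpa only [Ker_neg] using hnat

/-- The jump rate of the lazy random walk attached to the kernel. -/
noncomputable def rate (s : ℝ) : ℝ := 2 * ∑' z, Ker s z + 1

/-- The transition weights of the lazy random walk attached to the kernel. -/
noncomputable def lazyKer (s : ℝ) (z : ℤ) : ℝ :=
  Ker s z / rate s + if z = 0 then 1 - (∑' z, Ker s z) / rate s else 0

theorem rate_pos (hs : s ∈ Set.Ioo (0 : ℝ) 1) : 0 < rate s := by
  have : 0 ≤ ∑' z, Ker s z := tsum_nonneg (Ker_nonneg hs)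
  unfold rate
  linarith

theorem one_le_two_mul_lazyKer_zero (hs : s ∈ Set.Ioo (0 : ℝ) 1) : 1 ≤ 2 * lazyKer s 0 := by
  have h := rate_pos hs
  have h2 : (∑' z, Ker s z) / rate s ≤ 1 / 2 := by
    rw [div_le_iff₀ h, rate]
    linarith
  have h3 : Ker s 0 = 0 := by simp [Ker]
  simp only [lazyKer, h3, if_true, zero_div]
  linarith

theorem lazyKer_of_ne_zero {z : ℤ} (hz : z ≠ 0) : lazyKer s z = Ker s z / rate s := by
  simp [lazyKer, hz]

theorem lazyKer_nonneg (hs : s ∈ Set.Ioo (0 : ℝ) 1) (z : ℤ) : 0 ≤ lazyKer s z := by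
  rcases eq_or_ne z 0 with rfl | hz
  · linarith [one_le_two_mul_lazyKer_zero hs]
  · rw [lazyKer_of_ne_zero hz]
    exact div_nonneg (Ker_nonneg hs z) (rate_pos hs).le

theorem lazyKer_neg (z : ℤ) : lazyKer s (-z) = lazyKer s z := by
  simp [lazyKer, Ker_neg]

theorem hasSum_lazyKer (hs : s ∈ Set.Ioo (0 : ℝ) 1) : HasSum (lazyKer s) 1 := by
  have h := ((summable_Ker hs).hasSum.div_const (rate s)).add
    (hasSum_ite_eq (0 : ℤ) (1 - (∑' z, Ker s z) / rate s))
  rwa [add_sub_cancel] at h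

theorem rate_mul_lazyKer_mul (hs : s ∈ Set.Ioo (0 : ℝ) 1) (z : ℤ) {a : ℝ} (ha : z = 0 → a = 0) :
    rate s * (lazyKer s z * a) = Ker s z * a := by
  rcases eq_or_ne z 0 with rfl | hz
  · simp [ha rfl]
  · have := (rate_pos hs).ne'
    rw [lazyKer_of_ne_zero hz]
    field_simp

theorem Lop_eq (hs : s ∈ Set.Ioo (0 : ℝ) 1) {f : ℤ → ℝ} {B : ℝ} (hf : ∀ x, |f x| ≤ B) (x : ℤ) :
    Lop s f x = rate s * (f x - realAvg (lazyKer s) f x) := by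
  have hr := hasSum_lazyKer hs
  have h1 : f x - realAvg (lazyKer s) f x = ∑' z, lazyKer s z * (f x - f (x + z)) := by
    have h2 := (hr.mul_right (f x)).sub
      (summable_mul_of_bdd (lazyKer_nonneg hs) hr.summable fun z => hf (x + z)).hasSum
    rw [one_mul] at h2
    rw [realAvg, ← h2.tsum_eq]
    exact tsum_congr fun z => by ring
  rw [h1, ← tsum_mul_left, Lop, ← (Equiv.addLeft x).tsum_eq]
  refine tsum_congr fun z => ?_
  rw [rate_mul_lazyKer_mul hs z fun hz => by simp [hz]]
  simp only [Equiv.coe_addLeft, sub_add_cancel_left, Ker_neg]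
  ring

theorem ofReal_gradSq (hs : s ∈ Set.Ioo (0 : ℝ) 1) {u : ℤ → ℝ} {B : ℝ} (hu : ∀ x, |u x| ≤ B)
    (x : ℤ) : ENNReal.ofReal (gradSq s u x) = ENNReal.ofReal (rate s) * energy (lazyKer s) u x := by
  rw [energy, ← ofReal_tsum_mul_sq (B := B + B) (lazyKer_nonneg hs) (hasSum_lazyKer hs).summable
    (fun z => (abs_sub _ _).trans (add_le_add (hu _) (hu _))),
    ← ENNReal.ofReal_mul (rate_pos hs).le, ← tsum_mul_left, gradSq, ← (Equiv.addLeft x).tsum_eq]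
  congr 1
  refine tsum_congr fun z => ?_
  rw [rate_mul_lazyKer_mul hs z fun hz => by simp [hz]]
  simp only [Equiv.coe_addLeft, add_sub_cancel_left]
  ring

open BoundedContinuousFunction in
/-- The averaging operator as a continuous linear map on bounded functions. -/
noncomputable def avgCLM (r : ℤ → ℝ) (hr0 : ∀ z, 0 ≤ r z) (hr : HasSum r 1) :
    (ℤ →ᵇ ℝ) →L[ℝ] (ℤ →ᵇ ℝ) :=
  LinearMap.mkContinuous
    { toFun := fun F => ofNormedAddCommGroupDiscrete (realAvg r F) ‖F‖
        (abs_realAvg_le hr0 hr F.norm_coe_le_norm)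
      map_add' := fun F G => by
        ext x
        change realAvg r (F + G) x = realAvg r F x + realAvg r G x
        rw [realAvg, realAvg, realAvg, ← Summable.tsum_add
          (summable_mul_of_bdd hr0 hr.summable fun _ => F.norm_coe_le_norm _)
          (summable_mul_of_bdd hr0 hr.summable fun _ => G.norm_coe_le_norm _)]
        exact tsum_congr fun z => mul_add _ _ _
      map_smul' := fun c F => by
        ext x
        change realAvg r (c • F) x = c * realAvg r F x
        rw [realAvg, realAvg, ← tsum_mul_left]
        exact tsum_congr fun z => mul_left_comm _ _ _ } 1 fun F => by
    rw [one_mul]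
    exact norm_ofNormedAddCommGroup_le _ (norm_nonneg _) (abs_realAvg_le hr0 hr F.norm_coe_le_norm)

theorem avgCLM_pow_apply (r : ℤ → ℝ) (hr0 : ∀ z, 0 ≤ r z) (hr : HasSum r 1) (n : ℕ)
    (F : BoundedContinuousFunction ℤ ℝ) : ⇑((avgCLM r hr0 hr ^ n) F) = (realAvg r)^[n] F := by
  induction n with
  | zero => rfl
  | succ n ih =>
    rw [Function.iterate_succ_apply', pow_succ', ← ih]
    rfl

theorem exists_hasSum_exp_series_hasSum_poisson {A : Type*} [NormedRing A] [NormedAlgebra ℝ A]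
    [CompleteSpace A] (a t : ℝ) (T : A) :
    ∃ E : A, HasSum (fun n : ℕ => ((-t) ^ n / n.factorial) • (a • (1 - T)) ^ n) E ∧
      HasSum (fun n : ℕ => (Real.exp (-(a * t)) * ((a * t) ^ n / n.factorial)) • T ^ n) E := by
  have e : (-t) • a • (1 - T) = algebraMap ℝ A (-(a * t)) + (a * t) • T := by
    rw [Algebra.algebraMap_eq_smul_one, smul_smul, smul_sub, neg_mul, mul_comm t, neg_smul,
      neg_smul]
    abel
  let _ : NormedAlgebra ℚ A := NormedAlgebra.restrictScalars ℚ ℝ A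
  refine ⟨NormedSpace.exp ((-t) • a • (1 - T)),
    (NormedSpace.exp_series_hasSum_exp' (𝕂 := ℝ) ((-t) • a • (1 - T))).congr_fun fun n => ?_, ?_⟩
  · rw [smul_pow (-t), smul_smul, div_eq_inv_mul]
  rw [e, NormedSpace.exp_add_of_commute (Algebra.commutes _ _), ← NormedSpace.algebraMap_exp_comm,
    ← Real.exp_eq_exp_ℝ, ← Algebra.smul_def]
  refine ((NormedSpace.exp_series_hasSum_exp' (𝕂 := ℝ) ((a * t) • T)).const_smul _).congr_fun
    fun n => ?_
  rw [smul_pow, smul_smul, smul_smul]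
  congr 1
  ring

/-- The heat semigroup is a Poisson mixture of the powers of the lazy random walk. -/
theorem hasSum_heat (hs : s ∈ Set.Ioo (0 : ℝ) 1) {f : ℤ → ℝ} {B : ℝ} (hf : ∀ x, |f x| ≤ B)
    (t : ℝ) (x : ℤ) :
    HasSum (fun n : ℕ => Real.exp (-(rate s * t)) * ((rate s * t) ^ n / n.factorial) *
      (realAvg (lazyKer s))^[n] f x) (heat s t f x) := by
  set T := avgCLM (lazyKer s) (lazyKer_nonneg hs) (hasSum_lazyKer hs) with hT
  let F : BoundedContinuousFunction ℤ ℝ :=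
    BoundedContinuousFunction.ofNormedAddCommGroupDiscrete f B hf
  have hF : ⇑F = f := rfl
  have hL : ∀ n : ℕ, (Lop s)^[n] f = ⇑(((rate s • (1 - T)) ^ n) F) := fun n => by
    induction n with
    | zero => rfl
    | succ n ih =>
      rw [Function.iterate_succ_apply', ih, pow_succ']
      funext y
      exact Lop_eq hs (f := ⇑(((rate s • (1 - T)) ^ n) F)) (B := ‖((rate s • (1 - T)) ^ n) F‖)
        (((rate s • (1 - T)) ^ n) F).norm_coe_le_norm y
  let ev : (BoundedContinuousFunction ℤ ℝ →L[ℝ] BoundedContinuousFunction ℤ ℝ) →L[ℝ] ℝ :=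
    (BoundedContinuousFunction.evalCLM ℝ x).comp (ContinuousLinearMap.apply ℝ _ F)
  obtain ⟨E, hE1, hE2⟩ := exists_hasSum_exp_series_hasSum_poisson (rate s) t T
  have h1 := hE1.mapL ev
  have h2 := hE2.mapL ev
  have h3 : heat s t f x = ev E := by
    rw [← h1.tsum_eq, heat]
    refine tsum_congr fun n => ?_
    rw [hL, map_smul]
    rfl
  rw [h3]
  refine h2.congr_fun fun n => ?_
  rw [map_smul]
  change _ = _ * ((T ^ n) F) x
  rw [hT, avgCLM_pow_apply, hF]

theorem hasSum_poisson (a : ℝ) :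
    HasSum (fun n : ℕ => Real.exp (-a) * (a ^ n / n.factorial)) 1 := by
  have h := (NormedSpace.expSeries_div_hasSum_exp (𝔸 := ℝ) a).mul_left (Real.exp (-a))
  rwa [← Real.exp_eq_exp_ℝ, ← Real.exp_add, neg_add_cancel, Real.exp_zero] at h

theorem abs_heat_le (hs : s ∈ Set.Ioo (0 : ℝ) 1) {f : ℤ → ℝ} {B : ℝ} (hf : ∀ x, |f x| ≤ B)
    {t : ℝ} (ht : 0 ≤ t) (x : ℤ) : |heat s t f x| ≤ B := by
  have hr := (rate_pos hs).le
  rw [← (hasSum_heat hs hf t x).tsum_eq, ← one_mul B, ← Real.norm_eq_abs]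
  refine tsum_of_norm_bounded ((hasSum_poisson (rate s * t)).mul_right B) fun n => ?_
  rw [Real.norm_eq_abs, abs_mul, abs_of_nonneg (by positivity)]
  gcongr
  exact abs_iterate_realAvg_le (lazyKer_nonneg hs) (hasSum_lazyKer hs) hf n x

theorem energy_heat_le (hs : s ∈ Set.Ioo (0 : ℝ) 1) {f : ℤ → ℝ} {B : ℝ} (hf : ∀ x, |f x| ≤ B)
    {t : ℝ} (ht : 0 ≤ t) (x : ℤ) :
    energy (lazyKer s) (heat s t f) x ≤
      ∑' n : ℕ, ENNReal.ofReal (Real.exp (-(rate s * t)) * ((rate s * t) ^ n / n.factorial)) *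
        energy (lazyKer s) ((realAvg (lazyKer s))^[n] f) x := by
  have hr := (rate_pos hs).le
  have hb := abs_iterate_realAvg_le (lazyKer_nonneg hs) (hasSum_lazyKer hs) hf
  simp only [energy, ← ENNReal.tsum_mul_left]
  rw [ENNReal.tsum_comm]
  refine ENNReal.tsum_le_tsum fun z => ?_
  simp only [mul_left_comm _ (ENNReal.ofReal (lazyKer s z)), ENNReal.tsum_mul_left]
  gcongr
  rw [← ((hasSum_heat hs hf t (x + z)).sub (hasSum_heat hs hf t x)).tsum_eq]
  simp only [← mul_sub]
  exact ofReal_sq_tsum_mul_le (B := B + B) (fun n => by positivity) (hasSum_poisson (rate s * t))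
    fun n => (abs_sub _ _).trans (add_le_add (hb n _) (hb n _))

theorem lintegral_poisson_le {a : ℝ} (ha : 0 < a) (n : ℕ) :
    ENNReal.ofReal a * ∫⁻ t in Set.Ioi (0 : ℝ),
      ENNReal.ofReal (Real.exp (-(a * t)) * ((a * t) ^ n / n.factorial)) ≤ 1 := by
  rw [← lintegral_const_mul' _ _ ENNReal.ofReal_ne_top,
    ← ProbabilityTheory.lintegral_gammaPDF_eq_one (show (0 : ℝ) < n + 1 by positivity) ha]
  refine le_trans (le_of_eq ?_) (setLIntegral_le_lintegral (Set.Ioi 0) _)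
  refine setLIntegral_congr_fun measurableSet_Ioi fun t ht => ?_
  rw [Set.mem_Ioi] at ht
  rw [ProbabilityTheory.gammaPDF_of_nonneg ht.le, ← ENNReal.ofReal_mul ha.le, add_sub_cancel_right,
    Real.rpow_natCast, Real.Gamma_nat_eq_factorial]
  congr 1
  have : a ^ ((n : ℝ) + 1) = a ^ (n + 1) := by rw [← Real.rpow_natCast]; push_cast; rfl
  rw [this]
  ring

theorem ofReal_integral_le_lintegral {α : Type*} [MeasurableSpace α] {μ : Measure α} (g : α → ℝ) :
    ENNReal.ofReal (∫ a, g a ∂μ) ≤ ∫⁻ a, ENNReal.ofReal (g a) ∂μ := by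
  by_cases hg : Integrable g μ
  · rw [integral_eq_lintegral_pos_part_sub_lintegral_neg_part hg]
    exact (ENNReal.ofReal_le_ofReal (sub_le_self _ ENNReal.toReal_nonneg)).trans
      ENNReal.ofReal_toReal_le
  · simp [integral_undef hg]

theorem ofReal_integral_gradSq_heat_le (hs : s ∈ Set.Ioo (0 : ℝ) 1) {f : ℤ → ℝ} {B : ℝ}
    (hf : ∀ x, |f x| ≤ B) (x : ℤ) :
    ENNReal.ofReal (∫ t in Set.Ioi (0 : ℝ), gradSq s (heat s t f) x) ≤
      ∑' n, energy (lazyKer s) ((realAvg (lazyKer s))^[n] f) x := by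
  set E := fun n => energy (lazyKer s) ((realAvg (lazyKer s))^[n] f) x with hE
  calc _ ≤ ∫⁻ t in Set.Ioi (0 : ℝ), ENNReal.ofReal (gradSq s (heat s t f) x) :=
        ofReal_integral_le_lintegral _
    _ ≤ ∫⁻ t in Set.Ioi (0 : ℝ), ENNReal.ofReal (rate s) * ∑' n : ℕ,
          ENNReal.ofReal (Real.exp (-(rate s * t)) * ((rate s * t) ^ n / n.factorial)) * E n := by
        refine setLIntegral_mono' measurableSet_Ioi fun t ht => ?_
        have ht0 : 0 ≤ t := le_of_lt ht
        rw [ofReal_gradSq hs (abs_heat_le hs hf ht0)]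
        gcongr
        exact energy_heat_le hs hf ht0 x
    _ = ∑' n : ℕ, (ENNReal.ofReal (rate s) * ∫⁻ t in Set.Ioi (0 : ℝ),
          ENNReal.ofReal (Real.exp (-(rate s * t)) * ((rate s * t) ^ n / n.factorial))) * E n := by
        have hm : ∀ n : ℕ, Measurable fun t : ℝ =>
            ENNReal.ofReal (Real.exp (-(rate s * t)) * ((rate s * t) ^ n / n.factorial)) :=
          fun n => by fun_prop
        rw [lintegral_const_mul' _ _ ENNReal.ofReal_ne_top,
          lintegral_tsum fun n => ((hm n).mul_const _).aemeasurable, ← ENNReal.tsum_mul_left]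
        refine tsum_congr fun n => ?_
        rw [lintegral_mul_const _ (hm n), mul_assoc]
    _ ≤ _ := ENNReal.tsum_le_tsum fun n =>
        mul_le_of_le_one_left' (lintegral_poisson_le (rate_pos hs) n)

end kernel

/-- For every `q ∈ [2,∞)` there is `c_q > 0` (depending only on `q` and `s`) such that
`‖G f‖_q ≤ c_q ‖f‖_q` for every summable `f`, where
`G f x = (∫₀^∞ |∇ (P_t f)|²(x) dt)^{1/2}`. -/
theorem lq_bound_G (s : ℝ) (hs : s ∈ Set.Ioo (0 : ℝ) 1) (q : ℝ) (hq : 2 ≤ q) :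
    ∃ c : ℝ, 0 < c ∧ ∀ f : ℤ → ℝ, Summable f →
      lqNorm q (fun x => Real.sqrt (∫ t in Set.Ioi (0 : ℝ), gradSq s (heat s t f) x)) ≤
        c * lqNorm q f := by
  obtain ⟨C, hC, h⟩ := exists_tsum_tsum_energy_rpow_le (p := q / 2) (by linarith)
  have hq0 : 0 < q := by linarith
  refine ⟨(C.toReal + 1) ^ (1 / q), by positivity, fun f hf => ?_⟩
  have hfa : Summable fun x => |f x| := hf.abs
  have hB : ∀ x, |f x| ≤ ∑' y, |f y| := fun x => hfa.le_tsum x fun _ _ => abs_nonneg _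
  have hofr : ∀ x, ENNReal.ofReal |f x| ^ q = ENNReal.ofReal (f x ^ 2) ^ (q / 2) := fun x => by
    rw [← sq_abs, ENNReal.ofReal_pow (abs_nonneg _), ← ENNReal.rpow_natCast, ← ENNReal.rpow_mul]
    congr 1
    push_cast
    ring
  have hf1 : ∑' x, ENNReal.ofReal |f x| ≠ ∞ := by
    rw [← ENNReal.ofReal_tsum_of_nonneg (fun _ => abs_nonneg _) hfa]
    exact ENNReal.ofReal_ne_top
  have hpow : ∀ p : ℝ, 1 ≤ p → ∑' x, ENNReal.ofReal |f x| ^ p ≠ ∞ := fun p hp =>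
    ne_top_of_le_ne_top (ENNReal.rpow_ne_top_of_nonneg (by linarith) hf1)
      (tsum_rpow_le_rpow_tsum _ hp)
  have hsq : ∑' x, ENNReal.ofReal (f x ^ 2) ≠ ∞ := by
    convert hpow 2 (by norm_num) using 3 with x
    rw [ENNReal.rpow_two, ← ENNReal.ofReal_pow (abs_nonneg _), sq_abs]
  set A : ℤ → ℝ := fun x => ∫ t in Set.Ioi (0 : ℝ), gradSq s (heat s t f) x with hA
  have hmain : ∑' x, ENNReal.ofReal (A x) ^ (q / 2) ≤ C * ∑' x, ENNReal.ofReal |f x| ^ q := by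
    simp only [hofr]
    refine le_trans (ENNReal.tsum_le_tsum fun x => ?_) (h (lazyKer s) (lazyKer_nonneg hs)
      (hasSum_lazyKer hs) lazyKer_neg (one_le_two_mul_lazyKer_zero hs) f _ hB hsq)
    exact ENNReal.rpow_le_rpow (ofReal_integral_gradSq_heat_le hs hB x) (by linarith)
  have hV := hpow q (by linarith)
  have eA : ∀ x, |√(A x)| ^ q = (ENNReal.ofReal (A x) ^ (q / 2)).toReal := fun x => by
    rw [abs_of_nonneg (Real.sqrt_nonneg _), ← ENNReal.toReal_rpow, ENNReal.toReal_ofReal']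
    rcases le_total 0 (A x) with h0 | h0
    · rw [max_eq_left h0, Real.sqrt_eq_rpow, ← Real.rpow_mul h0]
      congr 1
      ring
    · rw [max_eq_right h0, Real.sqrt_eq_zero_of_nonpos h0, Real.zero_rpow hq0.ne',
        Real.zero_rpow (by positivity)]
  have ef : ∀ x, |f x| ^ q = (ENNReal.ofReal |f x| ^ q).toReal := fun x => by
    rw [← ENNReal.toReal_rpow, ENNReal.toReal_ofReal (abs_nonneg _)]
  have hle : ∑' x, |√(A x)| ^ q ≤ (C.toReal + 1) * ∑' x, |f x| ^ q := by
    simp only [eA, ef]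
    rw [← ENNReal.tsum_toReal_eq fun x => ENNReal.rpow_ne_top_of_nonneg (by linarith)
      ENNReal.ofReal_ne_top, ← ENNReal.tsum_toReal_eq fun x => ENNReal.rpow_ne_top_of_nonneg hq0.le
      ENNReal.ofReal_ne_top]
    refine (ENNReal.toReal_mono (ENNReal.mul_ne_top hC hV) hmain).trans ?_
    rw [ENNReal.toReal_mul]
    gcongr
    linarith
  have hnn : 0 ≤ ∑' x, |f x| ^ q := tsum_nonneg fun x => by positivity
  unfold lqNorm
  rw [← Real.mul_rpow (by positivity) hnn]
  exact Real.rpow_le_rpow (tsum_nonneg fun x => by positivity) hle (by positivity)
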